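/- For k ≥ 3, the closed candle H_k is isomorphic to the circulant graph C(2k, ±1, ±(k-1)). -/

import Mathlib

/-- The defining relation of the closed candle `H_k` on labels `ℤ/2kℤ`
(label `2k` is identified with `0`): two vertices of the same parity are joined
when they differ by `2` (giving the two `k`-cycles on the odd and the even labels,
each in cyclic order), and an odd `u` is joined to an even `v` when `v - u = 3`
or `v - u = -1` (this incorporates the wrap-around edges `(2k-1, 2)` and `(1, 2k)`). -/
def candleRel (k : ℕ) (u v : ZMod (2 * k)) : Prop :=
  (u.val % 2 = v.val % 2 ∧ v - u = 2) ∨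
  (u.val % 2 = 1 ∧ v.val % 2 = 0 ∧ (v - u = 3 ∨ v - u = -1))

/-- The closed candle `H_k` as a simple graph on `ℤ/2kℤ`. -/
def closedCandle (k : ℕ) : SimpleGraph (ZMod (2 * k)) :=
  SimpleGraph.fromRel (candleRel k)

/-- Sends the even labels `2b` to `b`, and the odd labels `2a + 1` to the representative of
`a + 1` modulo `k` that lies in the other half of `ℤ/2kℤ`. -/
def candleIndex (k n : ℕ) : ℕ :=
  if n % 2 = 0 then n / 2 else if n + 1 = 2 * k then k else (n + 1) / 2 + k

theorem candleIndex_lt {k n : ℕ} (h : n < 2 * k) : candleIndex k n < 2 * k := by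
  unfold candleIndex
  split_ifs <;> omega

theorem candleIndex_injOn {k m n : ℕ} (hm : m < 2 * k) (hn : n < 2 * k)
    (h : candleIndex k m = candleIndex k n) : m = n := by
  unfold candleIndex at h
  split_ifs at h <;> omega

theorem ZMod.natCast_add_self_eq_zero (k : ℕ) : (k : ZMod (2 * k)) + k = 0 := by
  have h := ZMod.natCast_self (2 * k)
  push_cast at h
  linear_combination h

theorem two_mul_candleIndex (k n : ℕ) :
    2 * (candleIndex k n : ZMod (2 * k)) = n + (n % 2 : ℕ) := by
  have hk := ZMod.natCast_add_self_eq_zero k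
  unfold candleIndex
  split_ifs with h₁ h₂
  · have h : ((2 * (n / 2) : ℕ) : ZMod (2 * k)) = (n + n % 2 : ℕ) := by congr 1; omega
    push_cast at h ⊢
    exact h
  · have h : ((2 * k : ℕ) : ZMod (2 * k)) = (n + n % 2 : ℕ) := by congr 1; omega
    push_cast at h ⊢
    exact h
  · have h : ((2 * ((n + 1) / 2) : ℕ) : ZMod (2 * k)) = (n + n % 2 : ℕ) := by congr 1; omega
    push_cast at h ⊢
    linear_combination h + hk

theorem ZMod.eq_zero_or_eq_of_two_mul_eq_zero {k : ℕ} [NeZero (2 * k)] {d : ZMod (2 * k)}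
    (h : 2 * d = 0) : d = 0 ∨ d = k := by
  have hd := ZMod.natCast_zmod_val d
  have hlt := ZMod.val_lt d
  have h' : ((2 * d.val : ℕ) : ZMod (2 * k)) = 0 := by
    push_cast
    rw [hd, h]
  rw [ZMod.natCast_eq_zero_iff] at h'
  obtain ⟨c, hc⟩ := Nat.dvd_of_mul_dvd_mul_left two_pos h'
  have hc2 : c < 2 := by
    by_contra! hge
    nlinarith
  interval_cases c
  · left
    rw [← hd, hc]
    simp
  · right
    rw [← hd, hc]
    simp

theorem ZMod.two_ne_zero_of_three_le {k : ℕ} (hk : 3 ≤ k) : (2 : ZMod (2 * k)) ≠ 0 := by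
  intro h
  have h' : ((2 : ℕ) : ZMod (2 * k)) = 0 := by exact_mod_cast h
  rw [ZMod.natCast_eq_zero_iff] at h'
  have := Nat.le_of_dvd two_pos h'
  omega

theorem mem_candle_connections_iff {k : ℕ} [NeZero (2 * k)] (d : ZMod (2 * k)) :
    d ∈ ({1, -1, ((k : ZMod (2 * k)) - 1), -((k : ZMod (2 * k)) - 1)} : Set (ZMod (2 * k))) ↔
      2 * d = 2 ∨ 2 * d = -2 := by
  have hk := ZMod.natCast_add_self_eq_zero k
  simp only [Set.mem_insert_iff, Set.mem_singleton_iff]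
  constructor
  · rintro (rfl | rfl | rfl | rfl)
    · left; ring
    · right; ring
    · right; linear_combination hk
    · left; linear_combination -hk
  · rintro (h | h)
    · rcases ZMod.eq_zero_or_eq_of_two_mul_eq_zero (d := d - 1)
        (by linear_combination h) with h | h
      · left; linear_combination h
      · right; right; right; linear_combination h + hk
    · rcases ZMod.eq_zero_or_eq_of_two_mul_eq_zero (d := d + 1)
        (by linear_combination h) with h | h
      · right; left; linear_combination h
      · right; right; left; linear_combination h

theorem circulantGraph_candle_adj_iff {k : ℕ} (hk : 3 ≤ k) [NeZero (2 * k)]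
    (a b : ZMod (2 * k)) :
    (SimpleGraph.circulantGraph
      ({1, -1, ((k : ZMod (2 * k)) - 1), -((k : ZMod (2 * k)) - 1)} :
        Set (ZMod (2 * k)))).Adj a b ↔ 2 * a - 2 * b = 2 ∨ 2 * a - 2 * b = -2 := by
  have h2 := ZMod.two_ne_zero_of_three_le hk
  rw [SimpleGraph.circulantGraph, SimpleGraph.fromRel_adj, mem_candle_connections_iff,
    mem_candle_connections_iff]
  constructor
  · rintro ⟨-, (h | h) | (h | h)⟩
    · left; linear_combination h
    · right; linear_combination h
    · right; linear_combination -h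
    · left; linear_combination -h
  · intro h
    refine ⟨?_, Or.inl ?_⟩
    · rintro rfl
      rcases h with h | h
      · exact h2 (by linear_combination -h)
      · exact h2 (by linear_combination h)
    · rwa [mul_sub]

theorem closedCandle_adj_iff {k : ℕ} (hk : 3 ≤ k) (u v : ZMod (2 * k)) :
    (closedCandle k).Adj u v ↔
      (u + (u.val % 2 : ℕ)) - (v + (v.val % 2 : ℕ)) = 2 ∨
        (u + (u.val % 2 : ℕ)) - (v + (v.val % 2 : ℕ)) = -2 := by
  have h2 := ZMod.two_ne_zero_of_three_le hk
  have hne : (u + (u.val % 2 : ℕ)) - (v + (v.val % 2 : ℕ)) = 2 ∨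
      (u + (u.val % 2 : ℕ)) - (v + (v.val % 2 : ℕ)) = -2 → u ≠ v := by
    rintro h rfl
    rcases h with h | h
    · exact h2 (by linear_combination -h)
    · exact h2 (by linear_combination h)
  rw [closedCandle, SimpleGraph.fromRel_adj]
  suffices h : candleRel k u v ∨ candleRel k v u ↔ _ from
    ⟨fun h' => h.1 h'.2, fun h' => ⟨hne h', h.2 h'⟩⟩
  unfold candleRel
  rcases Nat.mod_two_eq_zero_or_one u.val with hu | hu <;>
  rcases Nat.mod_two_eq_zero_or_one v.val with hv | hv <;>
  simp only [hu, hv, Nat.cast_zero, Nat.cast_one, true_and, false_and, zero_ne_one, one_ne_zero,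
    or_false, false_or] <;>
  constructor <;>
  rintro (h | h) <;>
  first
  | left; linear_combination h
  | left; linear_combination -h
  | right; linear_combination h
  | right; linear_combination -h

/-- For `k ≥ 3`, the closed candle `H_k` is isomorphic to the
circulant graph `C(2k, ±1, ±(k-1))`. -/
theorem stmt_18 (k : ℕ) (hk : 3 ≤ k) [NeZero (2 * k)] :
    Nonempty (closedCandle k ≃g
      SimpleGraph.circulantGraph
        ({1, -1, ((k : ZMod (2 * k)) - 1), -((k : ZMod (2 * k)) - 1)} :
          Set (ZMod (2 * k)))) := by
  have hinj : Function.Injective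
      fun u : ZMod (2 * k) => (candleIndex k u.val : ZMod (2 * k)) := by
    intro u v h
    have h' := congrArg ZMod.val h
    simp only [ZMod.val_cast_of_lt (candleIndex_lt (ZMod.val_lt _))] at h'
    exact ZMod.val_injective _ (candleIndex_injOn (ZMod.val_lt u) (ZMod.val_lt v) h')
  refine ⟨⟨Equiv.ofBijective _ (Finite.injective_iff_bijective.1 hinj), ?_⟩⟩
  intro u v
  rw [circulantGraph_candle_adj_iff hk, closedCandle_adj_iff hk]
  simp only [Equiv.ofBijective_apply, two_mul_candleIndex, ZMod.natCast_zmod_val]
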